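/- For the two-trader hamiltonian H and the portfolio operator Π̂₁ = P̂ n̂₁ + k̂₁ of trader 1, the operator identity P̂·[H, n̂₁] + [H, k̂₁] = 0 holds, and consequently [H, Π̂₁] = [H, P̂]·n̂₁ (so that in the Heisenberg picture the time derivative of the portfolio equals the time derivative of the price operator times the share number operator), where [A,B] = AB − BA. -/

import Mathlib

/- Context: the two-trader stock market with dynamical price. V is the free
complex vector space with orthonormal basis {φ_{n₁,n₂;k₁,k₂;O;m}}, realized
as finitely supported functions Idx2 →₀ ℂ. -/

noncomputable section

/-- The basis index: shares n₁,n₂, cash k₁,k₂, supply O, price m. -/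
structure Idx2 where
  n1 : ℕ
  n2 : ℕ
  k1 : ℕ
  k2 : ℕ
  O : ℕ
  m : ℕ
deriving DecidableEq

abbrev V2 := Idx2 →₀ ℂ

/-- Generic bosonic annihilation operator on the coordinate described by
`get`/`set`: φ ↦ √(index) · (φ with index lowered by one). -/
def ann (get : Idx2 → ℕ) (set : Idx2 → ℕ → Idx2) : Module.End ℂ V2 :=
  Finsupp.lift _ ℂ Idx2 fun i =>
    Finsupp.single (set i (get i - 1)) ((Real.sqrt (get i) : ℝ) : ℂ)

/-- Generic bosonic creation operator on the coordinate described by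
`get`/`set`: φ ↦ √(index+1) · (φ with index raised by one). -/
def cre (get : Idx2 → ℕ) (set : Idx2 → ℕ → Idx2) : Module.End ℂ V2 :=
  Finsupp.lift _ ℂ Idx2 fun i =>
    Finsupp.single (set i (get i + 1)) ((Real.sqrt (get i + 1) : ℝ) : ℂ)

def a1 : Module.End ℂ V2 := ann (·.n1) (fun i v => { i with n1 := v })
def a1dag : Module.End ℂ V2 := cre (·.n1) (fun i v => { i with n1 := v })
def a2 : Module.End ℂ V2 := ann (·.n2) (fun i v => { i with n2 := v })
def a2dag : Module.End ℂ V2 := cre (·.n2) (fun i v => { i with n2 := v })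
def c1 : Module.End ℂ V2 := ann (·.k1) (fun i v => { i with k1 := v })
def c1dag : Module.End ℂ V2 := cre (·.k1) (fun i v => { i with k1 := v })
def c2 : Module.End ℂ V2 := ann (·.k2) (fun i v => { i with k2 := v })
def c2dag : Module.End ℂ V2 := cre (·.k2) (fun i v => { i with k2 := v })
def oOp : Module.End ℂ V2 := ann (·.O) (fun i v => { i with O := v })
def odag : Module.End ℂ V2 := cre (·.O) (fun i v => { i with O := v })
def pOp : Module.End ℂ V2 := ann (·.m) (fun i v => { i with m := v })
def pdag : Module.End ℂ V2 := cre (·.m) (fun i v => { i with m := v })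

def n1hat : Module.End ℂ V2 := a1dag * a1
def n2hat : Module.End ℂ V2 := a2dag * a2
def k1hat : Module.End ℂ V2 := c1dag * c1
def k2hat : Module.End ℂ V2 := c2dag * c2
def Omegahat : Module.End ℂ V2 := odag * oOp
def Phat : Module.End ℂ V2 := pdag * pOp

/-- The operator c_j^P̂ : φ ↦ φ if m = 0; 0 if m > k_j;
√(k_j(k_j−1)⋯(k_j−m+1)) · (φ with k_j ↦ k_j−m) if 0 < m ≤ k_j. -/
def lowerPow (getk : Idx2 → ℕ) (setk : Idx2 → ℕ → Idx2) : Module.End ℂ V2 :=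
  Finsupp.lift _ ℂ Idx2 fun i =>
    if i.m ≤ getk i then
      Finsupp.single (setk i (getk i - i.m))
        ((Real.sqrt (∏ j ∈ Finset.range i.m, ((getk i : ℝ) - j)) : ℝ) : ℂ)
    else 0

/-- The operator (c_j†)^P̂ : φ ↦ φ if m = 0;
√((k_j+1)⋯(k_j+m)) · (φ with k_j ↦ k_j+m) if m > 0. -/
def raisePow (getk : Idx2 → ℕ) (setk : Idx2 → ℕ → Idx2) : Module.End ℂ V2 :=
  Finsupp.lift _ ℂ Idx2 fun i =>
    Finsupp.single (setk i (getk i + i.m))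
      ((Real.sqrt (∏ j ∈ Finset.range i.m, ((getk i : ℝ) + j + 1)) : ℝ) : ℂ)

def c1PowP : Module.End ℂ V2 := lowerPow (·.k1) (fun i v => { i with k1 := v })
def c1dagPowP : Module.End ℂ V2 := raisePow (·.k1) (fun i v => { i with k1 := v })
def c2PowP : Module.End ℂ V2 := lowerPow (·.k2) (fun i v => { i with k2 := v })
def c2dagPowP : Module.End ℂ V2 := raisePow (·.k2) (fun i v => { i with k2 := v })

/-- The two-trader hamiltonian
H = α₁n̂₁ + α₂n̂₂ + β₁k̂₁ + β₂k̂₂ + o†o + p†p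
  + ( a₁†a₂ c₁^P̂ (c₂†)^P̂ + a₁a₂† (c₁†)^P̂ c₂^P̂ ) + (o†p + p†o). -/
def Ham2 (α1 α2 β1 β2 : ℝ) : Module.End ℂ V2 :=
  ((α1 : ℂ) • n1hat + (α2 : ℂ) • n2hat + (β1 : ℂ) • k1hat + (β2 : ℂ) • k2hat)
    + odag * oOp + pdag * pOp
    + (a1dag * a2 * c1PowP * c2dagPowP + a1 * a2dag * c1dagPowP * c2PowP)
    + (odag * pOp + pdag * oOp)

/-- The commutator [A,B] = AB − BA. -/
def opComm (A B : Module.End ℂ V2) : Module.End ℂ V2 := A * B - B * A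

/-- `A` sends each basis vector `φ_i` to `w i • φ_{s i}`. -/
def IsWeightedShift (A : Module.End ℂ V2) (s : Idx2 → Idx2) (w : Idx2 → ℂ) : Prop :=
  ∀ i, A (Finsupp.single i 1) = Finsupp.single (s i) (w i)

lemma IsWeightedShift.apply_single {A : Module.End ℂ V2} {s : Idx2 → Idx2} {w : Idx2 → ℂ}
    (hA : IsWeightedShift A s w) (i : Idx2) (c : ℂ) :
    A (Finsupp.single i c) = Finsupp.single (s i) (c * w i) := by
  have h : Finsupp.single i c = c • Finsupp.single i (1 : ℂ) := by simp
  rw [h, map_smul, hA i, Finsupp.smul_single, smul_eq_mul]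

lemma IsWeightedShift.mul {A B : Module.End ℂ V2} {s t : Idx2 → Idx2} {w v : Idx2 → ℂ}
    (hA : IsWeightedShift A s w) (hB : IsWeightedShift B t v) :
    IsWeightedShift (A * B) (fun i => s (t i)) (fun i => v i * w (t i)) := fun i => by
  rw [Module.End.mul_apply, hB i, hA.apply_single]

lemma isWeightedShift_ann (get : Idx2 → ℕ) (set : Idx2 → ℕ → Idx2) :
    IsWeightedShift (ann get set) (fun i => set i (get i - 1))
      (fun i => ((Real.sqrt (get i) : ℝ) : ℂ)) := fun i => by
  simp only [ann, Finsupp.lift_apply, zero_smul, Finsupp.sum_single_index, one_smul]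

lemma isWeightedShift_cre (get : Idx2 → ℕ) (set : Idx2 → ℕ → Idx2) :
    IsWeightedShift (cre get set) (fun i => set i (get i + 1))
      (fun i => ((Real.sqrt (get i + 1) : ℝ) : ℂ)) := fun i => by
  simp only [cre, Finsupp.lift_apply, zero_smul, Finsupp.sum_single_index, one_smul]

lemma isWeightedShift_lowerPow (getk : Idx2 → ℕ) (setk : Idx2 → ℕ → Idx2) :
    IsWeightedShift (lowerPow getk setk) (fun i => setk i (getk i - i.m))
      (fun i => if i.m ≤ getk i then
        ((Real.sqrt (∏ j ∈ Finset.range i.m, ((getk i : ℝ) - j)) : ℝ) : ℂ) else 0) := fun i => by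
  simp only [lowerPow, Finsupp.lift_apply, zero_smul, Finsupp.sum_single_index, one_smul]
  split_ifs <;> simp

lemma isWeightedShift_raisePow (getk : Idx2 → ℕ) (setk : Idx2 → ℕ → Idx2) :
    IsWeightedShift (raisePow getk setk) (fun i => setk i (getk i + i.m))
      (fun i => ((Real.sqrt (∏ j ∈ Finset.range i.m, ((getk i : ℝ) + j + 1)) : ℝ) : ℂ)) :=
  fun i => by
  simp only [raisePow, Finsupp.lift_apply, zero_smul, Finsupp.sum_single_index, one_smul]

/-- The number operator of a coordinate is diagonal, with that coordinate as eigenvalue. -/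
lemma isWeightedShift_number {get : Idx2 → ℕ} {set : Idx2 → ℕ → Idx2}
    (get_set : ∀ i v, get (set i v) = v) (set_set : ∀ i u v, set (set i u) v = set i v)
    (set_get : ∀ i, set i (get i) = i) :
    IsWeightedShift (cre get set * ann get set) id (fun i => (get i : ℂ)) := fun i => by
  rw [(isWeightedShift_cre get set).mul (isWeightedShift_ann get set) i]
  rcases Nat.eq_zero_or_pos (get i) with h | h
  · simp [h]
  · have hcast : (((get i - 1 : ℕ) : ℝ) + 1) = get i := by
      exact_mod_cast Nat.sub_add_cancel h
    simp only [get_set, set_set, Nat.sub_add_cancel h, set_get, hcast, id]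
    rw [← Complex.ofReal_mul, Real.mul_self_sqrt (Nat.cast_nonneg _), Complex.ofReal_natCast]

lemma isWeightedShift_n1hat : IsWeightedShift n1hat id (fun i => (i.n1 : ℂ)) :=
  isWeightedShift_number (fun _ _ => rfl) (fun _ _ _ => rfl) (fun _ => rfl)

lemma isWeightedShift_n2hat : IsWeightedShift n2hat id (fun i => (i.n2 : ℂ)) :=
  isWeightedShift_number (fun _ _ => rfl) (fun _ _ _ => rfl) (fun _ => rfl)

lemma isWeightedShift_k1hat : IsWeightedShift k1hat id (fun i => (i.k1 : ℂ)) :=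
  isWeightedShift_number (fun _ _ => rfl) (fun _ _ _ => rfl) (fun _ => rfl)

lemma isWeightedShift_k2hat : IsWeightedShift k2hat id (fun i => (i.k2 : ℂ)) :=
  isWeightedShift_number (fun _ _ => rfl) (fun _ _ _ => rfl) (fun _ => rfl)

lemma isWeightedShift_Phat : IsWeightedShift Phat id (fun i => (i.m : ℂ)) :=
  isWeightedShift_number (fun _ _ => rfl) (fun _ _ _ => rfl) (fun _ => rfl)

lemma isWeightedShift_one : IsWeightedShift 1 id (fun _ => 1) := fun _ => rfl

lemma IsWeightedShift.smul {A : Module.End ℂ V2} {s : Idx2 → Idx2} {w : Idx2 → ℂ}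
    (hA : IsWeightedShift A s w) (c : ℂ) :
    IsWeightedShift (c • A) s (fun i => c * w i) := fun i => by
  rw [LinearMap.smul_apply, hA i, Finsupp.smul_single, smul_eq_mul]

lemma IsWeightedShift.neg {A : Module.End ℂ V2} {s : Idx2 → Idx2} {w : Idx2 → ℂ}
    (hA : IsWeightedShift A s w) : IsWeightedShift (-A) s (fun i => -w i) := fun i => by
  rw [LinearMap.neg_apply, hA i, Finsupp.single_neg]

lemma isWeightedShift_zero : IsWeightedShift 0 id (fun _ => 0) := fun _ => by simp

/-- If a weighted shift lowers the eigenvalue of a diagonal operator `D` by the eigenvalue of a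
diagonal operator `G` at the target, its commutator with `D` is multiplication by `G`. -/
lemma IsWeightedShift.opComm_eq {A D G : Module.End ℂ V2} {s : Idx2 → Idx2} {w d g : Idx2 → ℂ}
    (hA : IsWeightedShift A s w) (hD : IsWeightedShift D id d) (hG : IsWeightedShift G id g)
    (h : ∀ i, w i ≠ 0 → d i - d (s i) = g (s i)) :
    opComm A D = G * A := by
  refine Finsupp.lhom_ext fun i c => ?_
  simp only [opComm, LinearMap.sub_apply, Module.End.mul_apply, hA.apply_single, hD.apply_single,
    hG.apply_single, id, ← Finsupp.single_sub]
  congr 1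
  by_cases hw : w i = 0
  · simp [hw]
  · rw [← h i hw]
    ring

lemma IsWeightedShift.opComm_eq_zero {A D : Module.End ℂ V2} {s : Idx2 → Idx2} {w d : Idx2 → ℂ}
    (hA : IsWeightedShift A s w) (hD : IsWeightedShift D id d) (h : ∀ i, d (s i) = d i) :
    opComm A D = 0 := by
  have := hA.opComm_eq hD isWeightedShift_zero fun i _ => by simp [h]
  simpa using this

lemma opComm_add_left (A B C : Module.End ℂ V2) :
    opComm (A + B) C = opComm A C + opComm B C := by
  simp only [opComm, add_mul, mul_add]
  abel

lemma opComm_add_right (A B C : Module.End ℂ V2) :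
    opComm A (B + C) = opComm A B + opComm A C := by
  simp only [opComm, add_mul, mul_add]
  abel

lemma opComm_mul_right (A B C : Module.End ℂ V2) :
    opComm A (B * C) = opComm A B * C + B * opComm A C := by
  refine LinearMap.ext fun v => ?_
  simp only [opComm, LinearMap.add_apply, LinearMap.sub_apply, Module.End.mul_apply, map_sub]
  abel

lemma op_neg_mul (A B : Module.End ℂ V2) : -A * B = -(A * B) :=
  LinearMap.ext fun _ => rfl

lemma op_mul_neg (A B : Module.End ℂ V2) : A * -B = -(A * B) :=
  LinearMap.ext fun v => map_neg A (B v)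

/-- Trader 1 buys a share from trader 2 at the current price. -/
def buyTerm : Module.End ℂ V2 := a1dag * a2 * c1PowP * c2dagPowP

/-- Trader 1 sells a share to trader 2 at the current price. -/
def sellTerm : Module.End ℂ V2 := a1 * a2dag * c1dagPowP * c2PowP

lemma exists_isWeightedShift_buyTerm :
    ∃ w, IsWeightedShift buyTerm
      (fun i => ⟨i.n1 + 1, i.n2 - 1, i.k1 - i.m, i.k2 + i.m, i.O, i.m⟩) w ∧
      ∀ i, w i ≠ 0 → i.m ≤ i.k1 := by
  refine ⟨_, (((isWeightedShift_cre _ _).mul (isWeightedShift_ann _ _)).mul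
    (isWeightedShift_lowerPow _ _)).mul (isWeightedShift_raisePow _ _), fun i hi => ?_⟩
  by_contra hm
  simp [hm] at hi

lemma exists_isWeightedShift_sellTerm :
    ∃ w, IsWeightedShift sellTerm
      (fun i => ⟨i.n1 - 1, i.n2 + 1, i.k1 + i.m, i.k2 - i.m, i.O, i.m⟩) w ∧
      ∀ i, w i ≠ 0 → 1 ≤ i.n1 := by
  refine ⟨_, (((isWeightedShift_ann _ _).mul (isWeightedShift_cre _ _)).mul
    (isWeightedShift_raisePow _ _)).mul (isWeightedShift_lowerPow _ _), fun i hi => ?_⟩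
  by_contra hn
  simp [Nat.lt_one_iff.mp (not_le.mp hn)] at hi

lemma opComm_buyTerm_n1hat : opComm buyTerm n1hat = -buyTerm := by
  obtain ⟨w, hw, -⟩ := exists_isWeightedShift_buyTerm
  rw [hw.opComm_eq isWeightedShift_n1hat isWeightedShift_one.neg fun i _ => by simp,
    op_neg_mul, one_mul]

lemma opComm_buyTerm_k1hat : opComm buyTerm k1hat = Phat * buyTerm := by
  obtain ⟨w, hw, hm⟩ := exists_isWeightedShift_buyTerm
  exact hw.opComm_eq isWeightedShift_k1hat isWeightedShift_Phat fun i hi => by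
    simp [Nat.cast_sub (hm i hi)]

lemma opComm_sellTerm_n1hat : opComm sellTerm n1hat = sellTerm := by
  obtain ⟨w, hw, hn⟩ := exists_isWeightedShift_sellTerm
  rw [hw.opComm_eq isWeightedShift_n1hat isWeightedShift_one fun i hi => by
    simp [Nat.cast_sub (hn i hi)], one_mul]

lemma opComm_sellTerm_k1hat : opComm sellTerm k1hat = -(Phat * sellTerm) := by
  obtain ⟨w, hw, -⟩ := exists_isWeightedShift_sellTerm
  rw [hw.opComm_eq isWeightedShift_k1hat isWeightedShift_Phat.neg fun i _ => by simp, op_neg_mul]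

/-- Only the trading terms of the hamiltonian contribute to its commutator with a diagonal
operator whose eigenvalue depends neither on the supply nor on the price. -/
lemma opComm_Ham2 (α1 α2 β1 β2 : ℝ) {D : Module.End ℂ V2} {d : Idx2 → ℂ}
    (hD : IsWeightedShift D id d)
    (hO : ∀ (i : Idx2) (u : ℕ), d { i with O := u } = d i)
    (hm : ∀ (i : Idx2) (u : ℕ), d { i with m := u } = d i) :
    opComm (Ham2 α1 α2 β1 β2) D = opComm buyTerm D + opComm sellTerm D := by
  have hn1 := (isWeightedShift_n1hat.smul α1).opComm_eq_zero hD fun _ => rfl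
  have hn2 := (isWeightedShift_n2hat.smul α2).opComm_eq_zero hD fun _ => rfl
  have hk1 := (isWeightedShift_k1hat.smul β1).opComm_eq_zero hD fun _ => rfl
  have hk2 := (isWeightedShift_k2hat.smul β2).opComm_eq_zero hD fun _ => rfl
  have hoo : opComm (odag * oOp) D = 0 :=
    ((isWeightedShift_cre _ _).mul (isWeightedShift_ann _ _)).opComm_eq_zero hD
      fun i => by simp only [hO]
  have hpp : opComm (pdag * pOp) D = 0 :=
    ((isWeightedShift_cre _ _).mul (isWeightedShift_ann _ _)).opComm_eq_zero hD
      fun i => by simp only [hm]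
  have hop : opComm (odag * pOp) D = 0 :=
    ((isWeightedShift_cre _ _).mul (isWeightedShift_ann _ _)).opComm_eq_zero hD
      fun i => (hO _ _).trans (hm _ _)
  have hpo : opComm (pdag * oOp) D = 0 :=
    ((isWeightedShift_cre _ _).mul (isWeightedShift_ann _ _)).opComm_eq_zero hD
      fun i => (hm _ _).trans (hO _ _)
  simp only [Ham2, opComm_add_left, hn1, hn2, hk1, hk2, hoo, hpp, hop, hpo, add_zero, zero_add,
    buyTerm, sellTerm]

/-- for the portfolio Π̂₁ = P̂ n̂₁ + k̂₁ of trader 1 one has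
P̂·[H, n̂₁] + [H, k̂₁] = 0 and consequently [H, Π̂₁] = [H, P̂]·n̂₁. -/
theorem portfolio_commutator_identity (α1 α2 β1 β2 : ℝ) :
    Phat * opComm (Ham2 α1 α2 β1 β2) n1hat + opComm (Ham2 α1 α2 β1 β2) k1hat = 0 ∧
    opComm (Ham2 α1 α2 β1 β2) (Phat * n1hat + k1hat)
      = opComm (Ham2 α1 α2 β1 β2) Phat * n1hat := by
  have key : Phat * opComm (Ham2 α1 α2 β1 β2) n1hat + opComm (Ham2 α1 α2 β1 β2) k1hat = 0 := by
    rw [opComm_Ham2 α1 α2 β1 β2 isWeightedShift_n1hat (fun _ _ => rfl) (fun _ _ => rfl),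
      opComm_Ham2 α1 α2 β1 β2 isWeightedShift_k1hat (fun _ _ => rfl) (fun _ _ => rfl),
      opComm_buyTerm_n1hat, opComm_buyTerm_k1hat, opComm_sellTerm_n1hat, opComm_sellTerm_k1hat]
    rw [mul_add, op_mul_neg]
    abel
  refine ⟨key, ?_⟩
  rw [opComm_add_right, opComm_mul_right, add_assoc, key, add_zero]

end
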